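/- arXiv:2503.19845 — 2 statements merged into one kernel-verified Lean document; each statement's English description precedes it below -/
import Mathlib

section
/- Let X, Y be m×m real matrices with XᵀY = YᵀX and such that the 2m×m block column matrix [X;Y] has rank m, and regard them as complex matrices. Then W := (X+iY)(X−iY)⁻¹ is a symmetric unitary matrix (W = Wᵀ and WᴴW = I_m), and det W = det(X+iY)² / det(XᵀX+YᵀY), i.e., det W agrees with Arnold's map Det² evaluated at the Lagrangian plane spanned by the columns of [X;Y]. -/
open Matrix

theorem Matrix.isUnit_of_rank_eq_card {n K : Type*} [Fintype n] [DecidableEq n] [Field K]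
    (A : Matrix n n K) (h : A.rank = Fintype.card n) : IsUnit A := by
  rw [← Matrix.linearIndependent_cols_iff_isUnit, linearIndependent_iff_card_eq_finrank_span,
    ← h, Matrix.rank_eq_finrank_span_cols]
  rfl

/-- For a real Lagrangian frame `(X, Y)` (i.e. `XᵀY = YᵀX` and
`[X; Y]` has rank `m`), viewed as complex matrices, `W = (X + iY)(X - iY)⁻¹` is a
symmetric unitary matrix and `det W = det (X + iY)² / det (XᵀX + YᵀY)`, i.e. `det W`
agrees with Arnold's map `Det²`. -/
theorem real_lagrangian_frame_W_symmetric_unitary (m : ℕ) (X Y : Matrix (Fin m) (Fin m) ℝ)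
    (hsym : Xᵀ * Y = Yᵀ * X)
    (hrank : (Matrix.fromRows X Y).rank = m)
    (Xc Yc W : Matrix (Fin m) (Fin m) ℂ)
    (hXc : Xc = X.map (Complex.ofReal)) (hYc : Yc = Y.map (Complex.ofReal))
    (hW : W = (Xc + Complex.I • Yc) * (Xc - Complex.I • Yc)⁻¹) :
    W = Wᵀ ∧ Wᴴ * W = 1 ∧
    W.det = (Xc + Complex.I • Yc).det ^ 2 / ((Xᵀ * X + Yᵀ * Y).det : ℂ) := by
  have hS : (Xᵀ * X + Yᵀ * Y).det ≠ 0 := by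
    have h : (Xᵀ * X + Yᵀ * Y).rank = Fintype.card (Fin m) := by
      rw [Fintype.card_fin, ← fromCols_mul_fromRows, ← transpose_fromRows,
        rank_transpose_mul_self, hrank]
    exact ((isUnit_iff_isUnit_det _).1 (isUnit_of_rank_eq_card _ h)).ne_zero
  have hXh : Xcᴴ = Xcᵀ := by subst hXc; ext; simp
  have hYh : Ycᴴ = Ycᵀ := by subst hYc; ext; simp
  have hsymc : Xcᵀ * Yc = Ycᵀ * Xc := by
    have h := congrArg (fun M => M.map Complex.ofRealHom) hsym
    simp only [Matrix.map_mul] at h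
    subst hXc hYc
    exact h
  have hSc : (Xcᵀ * Xc + Ycᵀ * Yc).det = ((Xᵀ * X + Yᵀ * Y).det : ℂ) := by
    have h := Complex.ofRealHom.map_det (Xᵀ * X + Yᵀ * Y)
    rw [RingHom.map_add, RingHom.map_mul, RingHom.map_mul] at h
    subst hXc hYc
    exact h.symm
  set P := Xc + Complex.I • Yc with hP
  set Q := Xc - Complex.I • Yc with hQ
  have hPh : Pᴴ = Qᵀ := by
    simp [hP, hQ, hXh, hYh, sub_eq_add_neg]
  have hQh : Qᴴ = Pᵀ := by
    simp [hP, hQ, hXh, hYh, sub_eq_add_neg]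
  have hPQ : Pᵀ * Q = Xcᵀ * Xc + Ycᵀ * Yc := by
    simp only [hP, hQ, transpose_add, transpose_smul, add_mul, mul_sub, smul_mul_assoc,
      mul_smul_comm, hsymc]
    linear_combination (norm := module) (-Complex.I_mul_I) • (Ycᵀ * Yc)
  have hQP : Qᵀ * P = Pᵀ * Q := by
    rw [hPQ]
    simp only [hP, hQ, transpose_sub, transpose_smul, sub_mul, mul_add, smul_mul_assoc,
      mul_smul_comm, hsymc]
    linear_combination (norm := module) (-Complex.I_mul_I) • (Ycᵀ * Yc)
  have hdet : P.det * Q.det = ((Xᵀ * X + Yᵀ * Y).det : ℂ) := by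
    rw [← hSc, ← hPQ, det_mul, det_transpose]
  have hne : P.det * Q.det ≠ 0 := hdet ▸ Complex.ofReal_ne_zero.2 hS
  have hP0 : P.det ≠ 0 := left_ne_zero_of_mul hne
  have hQ0 : Q.det ≠ 0 := right_ne_zero_of_mul hne
  have hQu : IsUnit Q.det := hQ0.isUnit
  have hQtu : IsUnit Qᵀ.det := by rwa [det_transpose]
  have hWs : W = Wᵀ := by
    rw [hW, transpose_mul, transpose_nonsing_inv]
    calc P * Q⁻¹ = Qᵀ⁻¹ * (Qᵀ * P) * Q⁻¹ := by rw [nonsing_inv_mul_cancel_left _ _ hQtu]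
      _ = Qᵀ⁻¹ * Pᵀ := by
        rw [hQP, ← Matrix.mul_assoc, mul_nonsing_inv_cancel_right _ _ hQu]
  refine ⟨hWs, ?_, ?_⟩
  · have hQhu : IsUnit Qᴴ.det := by rw [det_conjTranspose]; exact hQu.star
    calc Wᴴ * W = Qᴴ⁻¹ * (Pᴴ * P) * Q⁻¹ := by
          rw [hW, conjTranspose_mul, conjTranspose_nonsing_inv]
          simp only [Matrix.mul_assoc]
      _ = 1 := by
          rw [hPh, hQP, ← hQh, nonsing_inv_mul_cancel_left _ _ hQhu, mul_nonsing_inv _ hQu]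
  · rw [← hdet, hW, det_mul, det_nonsing_inv, Ring.inverse_eq_inv']
    field_simp
end

section
/- Let (X,Y) be a Lagrangian frame of size m, i.e., X, Y are m×m complex matrices with XᴴY = YᴴX and the 2m×m block column matrix [X;Y] has rank m, and let W := (X+iY)(X−iY)⁻¹. Then for every z ∈ ℂ^m one has W z = z if and only if Yᴴ z = 0. In particular, the eigenspace of W associated with the eigenvalue 1 equals the kernel of Yᴴ, and its dimension equals the dimension of the kernel of Y. -/
open Matrix

/-- A square complex matrix of full rank is invertible. -/
theorem Matrix.isUnit_of_rank_eq {m : ℕ} {A : Matrix (Fin m) (Fin m) ℂ} (h : A.rank = m) :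
    IsUnit A := by
  rw [← Matrix.mulVec_surjective_iff_isUnit]
  have hr : LinearMap.range A.mulVecLin = ⊤ := by
    apply Submodule.eq_top_of_finrank_eq
    simpa [Matrix.rank] using h
  exact LinearMap.range_eq_top.mp hr

open scoped ComplexOrder in
/-- The Gram matrix of a full rank block column `[X; Y]` is invertible. -/
theorem isUnit_gram_of_rank_fromRows {m : ℕ} {X Y : Matrix (Fin m) (Fin m) ℂ}
    (hrank : (Matrix.fromRows X Y).rank = m) : IsUnit (Xᴴ * X + Yᴴ * Y) := by
  apply Matrix.isUnit_of_rank_eq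
  rw [← Matrix.fromCols_mul_fromRows, ← Matrix.conjTranspose_fromRows_eq_fromCols_conjTranspose,
    Matrix.rank_conjTranspose_mul_self, hrank]

/-- For a Lagrangian frame `(X, Y)` of size `m` with associated unitary
`W = (X + iY)(X - iY)⁻¹`: for every `z ∈ ℂᵐ`, `W z = z` iff `Yᴴ z = 0`; the eigenspace
of `W` for the eigenvalue `1` equals the kernel of `Yᴴ`, and its dimension equals the
dimension of the kernel of `Y`. -/
theorem lagrangian_frame_W_fixed_vectors (m : ℕ) (X Y : Matrix (Fin m) (Fin m) ℂ)
    (hsym : Xᴴ * Y = Yᴴ * X)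
    (hrank : (Matrix.fromRows X Y).rank = m)
    (W : Matrix (Fin m) (Fin m) ℂ)
    (hW : W = (X + Complex.I • Y) * (X - Complex.I • Y)⁻¹) :
    (∀ z : Fin m → ℂ, W.mulVec z = z ↔ Yᴴ.mulVec z = 0) ∧
    Module.End.eigenspace (Matrix.mulVecLin W) 1 = LinearMap.ker (Matrix.mulVecLin Yᴴ) ∧
    Module.finrank ℂ (LinearMap.ker (Matrix.mulVecLin Yᴴ)) =
      Module.finrank ℂ (LinearMap.ker (Matrix.mulVecLin Y)) := by
  have hgram := isUnit_gram_of_rank_fromRows hrank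
  have hA : IsUnit (X - Complex.I • Y) := by
    have h : (X - Complex.I • Y)ᴴ * (X - Complex.I • Y) = Xᴴ * X + Yᴴ * Y := by
      simp [sub_eq_add_neg, add_mul, mul_add, smul_smul, hsym]
      abel
    exact isUnit_of_mul_isUnit_right (h ▸ hgram)
  have hB : IsUnit (X + Complex.I • Y) := by
    have h : (X + Complex.I • Y)ᴴ * (X + Complex.I • Y) = Xᴴ * X + Yᴴ * Y := by
      simp [add_mul, mul_add, smul_smul, hsym]
    exact isUnit_of_mul_isUnit_right (h ▸ hgram)
  have hWA : W * (X - Complex.I • Y) = X + Complex.I • Y := by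
    rw [hW, Matrix.nonsing_inv_mul_cancel_right _ _ ((Matrix.isUnit_iff_isUnit_det _).mp hA)]
  have key : (X + Complex.I • Y)ᴴ * (W - 1) = (2 * Complex.I) • Yᴴ := by
    apply hA.mul_right_cancel
    rw [mul_assoc, sub_mul, hWA, one_mul]
    have h : X + Complex.I • Y - (X - Complex.I • Y) = (2 * Complex.I) • Y := by
      module
    rw [h, mul_smul_comm, smul_mul_assoc]
    congr 1
    simp [add_mul, mul_add, hsym, sub_eq_add_neg]
  have hfix (z : Fin m → ℂ) : W.mulVec z = z ↔ Yᴴ.mulVec z = 0 := by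
    have hz := congrArg (fun M => M.mulVec z) key
    simp only [← Matrix.mulVec_mulVec, Matrix.sub_mulVec, Matrix.one_mulVec,
      Matrix.smul_mulVec] at hz
    have hinj := Matrix.mulVec_injective_of_isUnit hB.star
    rw [← sub_eq_zero, ← hinj.eq_iff, Matrix.mulVec_zero, Matrix.star_eq_conjTranspose, hz,
      smul_eq_zero]
    simp
  refine ⟨hfix, ?_, ?_⟩
  · ext z
    simpa [Module.End.mem_eigenspace_iff] using hfix z
  · have h₁ := LinearMap.finrank_range_add_finrank_ker (Matrix.mulVecLin Yᴴ)
    have h₂ := LinearMap.finrank_range_add_finrank_ker (Matrix.mulVecLin Y)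
    have h₃ : Yᴴ.rank = Y.rank := by
      open scoped ComplexOrder in exact Matrix.rank_conjTranspose Y
    simp only [Matrix.rank] at h₃
    omega
end
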